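/- arXiv:math/0304218 — 2 statements merged into one kernel-verified Lean document; each statement's English description precedes it below -/
import Mathlib

section
/- Let k be any field and n ≥ 4. For every w ∈ ℝ^{C(n,2)} such that in_w(I_{2,n}) contains no monomial, there exist a permutation π of {1,…,n} and a monomial order ≺ on k[p_{ij}] such that the initial monomial ideal in_≺(in_{π·w}(I_{2,n})) equals the crossing ideal M = ⟨ p_{ik}p_{jl} : 1 ≤ i < j < k < l ≤ n ⟩, where (π·w)_{ij} = w_{π(i)π(j)}. Consequently there exists a single maximal Gröbner cone of the Plücker ideal I_{2,n} which contains, up to permuting the indices 1,…,n, all cones of the tropical Grassmannian G_{2,n}. -/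
open scoped Classical

open MvPolynomial

/-- The `w`-weight of an exponent vector `a`, namely `∑ aᵢ wᵢ`. -/
noncomputable def expWeight {σ : Type*} (w : σ → ℝ) (a : σ →₀ ℕ) : ℝ :=
  a.sum fun i e => (e : ℝ) * w i

/-- The initial form of `f` with respect to the weight vector `w`: the sum of the terms of `f`
of minimal `w`-weight. -/
noncomputable def initForm {σ : Type*} {k : Type*} [CommRing k] (w : σ → ℝ)
    (f : MvPolynomial σ k) : MvPolynomial σ k :=
  ∑ a ∈ f.support.filter (fun a => ∀ b ∈ f.support, expWeight w a ≤ expWeight w b),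
    monomial a (f.coeff a)

/-- The initial ideal `in_w(I) = ⟨in_w(f) : f ∈ I⟩`. -/
noncomputable def initIdeal {σ : Type*} {k : Type*} [CommRing k] (w : σ → ℝ)
    (I : Ideal (MvPolynomial σ k)) : Ideal (MvPolynomial σ k) :=
  Ideal.span { g | ∃ f ∈ I, g = initForm w f }

/-- A monomial: a nonzero scalar multiple of a product of variables. -/
def IsMonomial {σ : Type*} {k : Type*} [CommRing k] (g : MvPolynomial σ k) : Prop :=
  ∃ (a : σ →₀ ℕ) (c : k), c ≠ 0 ∧ g = monomial a c

/-- An ideal is monomial-free if it contains no monomial. -/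
def MonomialFree {σ : Type*} {k : Type*} [CommRing k] (I : Ideal (MvPolynomial σ k)) : Prop :=
  ∀ g ∈ I, ¬ IsMonomial g

/-- The Plücker (algebra) map, sending the variable `p_S` (for a `d`-subset `S` of `{0,…,n-1}`)
to the `d × d` minor on the columns indexed by `S` of a `d × n` matrix of indeterminates. -/
noncomputable def pluckerMap (k : Type*) [CommRing k] (d n : ℕ) :
    MvPolynomial {s : Finset (Fin n) // s.card = d} k →ₐ[k] MvPolynomial (Fin d × Fin n) k :=
  aeval fun S =>
    (Matrix.of fun r c : Fin d => (X (r, ((S.1.orderIsoOfFin S.2 c : S.1) : Fin n)) :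
       MvPolynomial (Fin d × Fin n) k)).det

/-- The Plücker ideal `I_{d,n}`: the ideal of algebraic relations among the maximal
minors of a generic `d × n` matrix. -/
noncomputable def pluckerIdeal (k : Type*) [CommRing k] (d n : ℕ) :
    Ideal (MvPolynomial {s : Finset (Fin n) // s.card = d} k) :=
  RingHom.ker (pluckerMap k d n)

/-- The variable index `p_{ij}` for `i ≠ j`. -/
def pr {n : ℕ} (i j : Fin n) (h : i ≠ j) : {s : Finset (Fin n) // s.card = 2} :=
  ⟨{i, j}, Finset.card_pair h⟩

/-- The minimum of three reals is attained at least twice. -/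
def minTwice (a b c : ℝ) : Prop :=
  (a = b ∧ a ≤ c) ∨ (a = c ∧ a ≤ b) ∨ (b = c ∧ b ≤ a)

/-- A monomial order on the monomials of a polynomial ring with variables indexed by `σ`:
a multiplicative well-ordering. -/
structure MonoOrder (σ : Type*) where
  lt : (σ →₀ ℕ) → (σ →₀ ℕ) → Prop
  trichot : ∀ a b, lt a b ∨ a = b ∨ lt b a
  trans : ∀ a b c, lt a b → lt b c → lt a c
  irrefl : ∀ a, ¬ lt a a
  add_right : ∀ a b c, lt a b → lt (a + c) (b + c)
  wf : WellFounded lt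

/-- The initial monomial ideal `in_≺(J)` of an ideal `J` with respect to a monomial order
(with the minimum convention: the initial monomial of `f ≠ 0` is the `≺`-smallest monomial
in its support). -/
noncomputable def ordInitIdeal {σ : Type*} {k : Type*} [CommRing k] (o : MonoOrder σ)
    (J : Ideal (MvPolynomial σ k)) : Ideal (MvPolynomial σ k) :=
  Ideal.span { g | ∃ f ∈ J, f ≠ 0 ∧ ∃ a ∈ f.support,
    (∀ b ∈ f.support, b ≠ a → o.lt a b) ∧ g = monomial a (1 : k) }

/-- The crossing ideal `M = ⟨ p_{ik} p_{jl} : 1 ≤ i < j < k < l ≤ n ⟩` generated by the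
crossing pairs of edges of the `n`-gon. -/
noncomputable def crossingIdeal (k : Type*) [CommRing k] (n : ℕ) :
    Ideal (MvPolynomial {s : Finset (Fin n) // s.card = 2} k) :=
  Ideal.span { g | ∃ (i j l m : Fin n) (hij : i < j) (hjl : j < l) (hlm : l < m),
    g = X (pr i l (hij.trans hjl).ne) * X (pr j m (hjl.trans hlm).ne) }

/-- The action of a permutation `π` of `{1,…,n}` on weight vectors:
`(π·w)_{ij} = w_{π(i)π(j)}`. -/
def permWeight {n : ℕ} (π : Equiv.Perm (Fin n)) (w : {s : Finset (Fin n) // s.card = 2} → ℝ) :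
    {s : Finset (Fin n) // s.card = 2} → ℝ :=
  fun S => w ⟨S.1.image π, (Finset.card_image_of_injective S.1 π.injective).trans S.2⟩

section Helpers

variable {n : ℕ}

abbrev Edge (n : ℕ) := {s : Finset (Fin n) // s.card = 2}

noncomputable def lo (S : Edge n) : Fin n := S.1.orderEmbOfFin S.2 0
noncomputable def hi (S : Edge n) : Fin n := S.1.orderEmbOfFin S.2 1

lemma lo_lt_hi (S : Edge n) : lo S < hi S := by
  unfold lo hi
  exact (S.1.orderEmbOfFin S.2).strictMono (by decide)

lemma pr_lo_hi (S : Edge n) : pr (lo S) (hi S) (lo_lt_hi S).ne = S := by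
  apply Subtype.ext
  unfold pr
  apply Finset.eq_of_subset_of_card_le
  · intro x hx
    simp only [Finset.mem_insert, Finset.mem_singleton] at hx
    rcases hx with rfl | rfl
    · exact Finset.orderEmbOfFin_mem _ _ _
    · exact Finset.orderEmbOfFin_mem _ _ _
  · rw [S.2, Finset.card_pair (lo_lt_hi S).ne]

lemma lo_hi_pr {i j : Fin n} (h : i < j) : lo (pr i j h.ne) = i ∧ hi (pr i j h.ne) = j := by
  have h1 := congrArg Subtype.val (pr_lo_hi (pr i j h.ne))
  have h2 := lo_lt_hi (pr i j h.ne)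
  simp only [pr] at h1
  change ({lo (pr i j h.ne), hi (pr i j h.ne)} : Finset (Fin n)) = {i, j} at h1
  generalize lo (pr i j h.ne) = a at *
  generalize hi (pr i j h.ne) = b at *
  have ha : a ∈ ({i, j} : Finset (Fin n)) := h1 ▸ (by simp)
  have hb : b ∈ ({i, j} : Finset (Fin n)) := h1 ▸ (by simp)
  simp only [Finset.mem_insert, Finset.mem_singleton] at ha hb
  rcases ha with rfl | rfl <;> rcases hb with rfl | rfl
  · exact absurd h2 (lt_irrefl _)
  · exact ⟨rfl, rfl⟩
  · exact absurd h2 (not_lt.2 h.le)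
  · exact absurd h2 (lt_irrefl _)

lemma lo_pr {i j : Fin n} (h : i < j) (h' : i ≠ j) : lo (pr i j h') = i := (lo_hi_pr h).1
lemma hi_pr {i j : Fin n} (h : i < j) (h' : i ≠ j) : hi (pr i j h') = j := (lo_hi_pr h).2

lemma pr_comm (i j : Fin n) (h : i ≠ j) : pr i j h = pr j i h.symm := by
  apply Subtype.ext; simp [pr, Finset.pair_comm]

lemma expWeight_eq {σ : Type*} (w : σ → ℝ) (a : σ →₀ ℕ) :
    expWeight w a = Finsupp.weight w a := by
  simp [expWeight, Finsupp.weight_apply]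

lemma expWeight_add {σ : Type*} (w : σ → ℝ) (a b : σ →₀ ℕ) :
    expWeight w (a + b) = expWeight w a + expWeight w b := by
  simp [expWeight_eq]

lemma expWeight_single {σ : Type*} (w : σ → ℝ) (i : σ) :
    expWeight w (Finsupp.single i 1) = w i := by
  simp [expWeight]

lemma coeff_initForm {σ : Type*} {k : Type*} [CommRing k] (w : σ → ℝ)
    (f : MvPolynomial σ k) (b : σ →₀ ℕ) :
    (initForm w f).coeff b =
      if ∀ c ∈ f.support, expWeight w b ≤ expWeight w c then f.coeff b else 0 := by
  unfold initForm
  rw [coeff_sum]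
  simp only [coeff_monomial]
  rw [Finset.sum_ite_eq']
  simp only [Finset.mem_filter, mem_support_iff]
  by_cases h : coeff b f = 0
  · simp [h]
  · simp [h]

lemma pluckerMap_X (k : Type*) [CommRing k] (S : Edge n) :
    pluckerMap k 2 n (X S) = X (0, lo S) * X (1, hi S) - X (0, hi S) * X (1, lo S) := by
  unfold pluckerMap
  rw [aeval_X, Matrix.det_fin_two]
  simp only [Matrix.of_apply, Finset.coe_orderIsoOfFin_apply]
  unfold lo hi
  ring

noncomputable def sg (k : Type*) [CommRing k] (i j : Fin n) : k := if i < j then 1 else -1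

lemma sg_ne (k : Type*) [Field k] (i j : Fin n) : sg k i j ≠ 0 := by
  unfold sg; split_ifs <;> simp

lemma sg_lt (k : Type*) [CommRing k] {i j : Fin n} (h : i < j) : sg k i j = 1 := by
  simp [sg, h]

lemma pluckerMap_q (k : Type*) [CommRing k] (i j : Fin n) (h : i ≠ j) :
    pluckerMap k 2 n (C (sg k i j) * X (pr i j h)) = X (0, i) * X (1, j) - X (0, j) * X (1, i) := by
  rw [map_mul, pluckerMap_X]
  rcases lt_or_gt_of_ne h with h1 | h1
  · rw [sg_lt k h1, lo_pr h1, hi_pr h1]; simp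
  · rw [pr_comm, lo_pr h1, hi_pr h1]
    have : sg k i j = -1 := by simp [sg, not_lt.2 h1.le]
    rw [this]; simp

noncomputable def e2 (i j : Fin n) (h : i ≠ j) (l m : Fin n) (h' : l ≠ m) : Edge n →₀ ℕ :=
  Finsupp.single (pr i j h) 1 + Finsupp.single (pr l m h') 1

noncomputable def plu (k : Type*) [CommRing k] (a b c d : Fin n) (ab : a ≠ b) (ac : a ≠ c)
    (ad : a ≠ d) (bc : b ≠ c) (bd : b ≠ d) (cd : c ≠ d) : MvPolynomial (Edge n) k :=
  monomial (e2 a c ac b d bd) (sg k a c * sg k b d) - monomial (e2 a b ab c d cd) (sg k a b * sg k c d)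
    - monomial (e2 a d ad b c bc) (sg k a d * sg k b c)

lemma mon_e2 (k : Type*) [CommRing k] (a b c d : Fin n) (ab : a ≠ b) (cd : c ≠ d) (x y : k) :
    monomial (e2 a b ab c d cd) (x * y) = (C x * X (pr a b ab)) * (C y * X (pr c d cd)) := by
  simp only [X, C_mul_monomial, e2, monomial_mul, mul_one]

lemma plu_mem (k : Type*) [CommRing k] (a b c d : Fin n) (ab : a ≠ b) (ac : a ≠ c)
    (ad : a ≠ d) (bc : b ≠ c) (bd : b ≠ d) (cd : c ≠ d) :
    plu k a b c d ab ac ad bc bd cd ∈ pluckerIdeal k 2 n := by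
  rw [pluckerIdeal, RingHom.mem_ker]
  unfold plu
  have hm : ∀ (a b c d : Fin n) (ab : a ≠ b) (cd : c ≠ d),
      pluckerMap k 2 n (monomial (e2 a b ab c d cd) (sg k a b * sg k c d)) =
        (X (0, a) * X (1, b) - X (0, b) * X (1, a)) * (X (0, c) * X (1, d) - X (0, d) * X (1, c)) := by
    intro a b c d ab cd
    rw [mon_e2, map_mul, pluckerMap_q, pluckerMap_q]
  rw [map_sub, map_sub, hm, hm, hm]
  ring

/-- Four point condition. -/
lemma four_point (k : Type) [Field k] (w : Edge n → ℝ)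
    (hw : MonomialFree (initIdeal w (pluckerIdeal k 2 n)))
    (a b c d : Fin n) (ab : a ≠ b) (ac : a ≠ c)
    (ad : a ≠ d) (bc : b ≠ c) (bd : b ≠ d) (cd : c ≠ d)
    (h1 : w (pr a c ac) + w (pr b d bd) < w (pr a b ab) + w (pr c d cd))
    (h2 : w (pr a c ac) + w (pr b d bd) < w (pr a d ad) + w (pr b c bc)) : False := by
  have hwt : ∀ (i j : Fin n) (h : i ≠ j) (l m : Fin n) (h' : l ≠ m),
      expWeight w (e2 i j h l m h') = w (pr i j h) + w (pr l m h') := by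
    intros; simp [e2, expWeight_add, expWeight_single]
  have h1' : expWeight w (e2 a c ac b d bd) < expWeight w (e2 a b ab c d cd) := by
    rw [hwt, hwt]; exact h1
  have h2' : expWeight w (e2 a c ac b d bd) < expWeight w (e2 a d ad b c bc) := by
    rw [hwt, hwt]; exact h2
  have n1 : e2 a b ab c d cd ≠ e2 a c ac b d bd := fun h => by rw [h] at h1'; exact lt_irrefl _ h1'
  have n2 : e2 a d ad b c bc ≠ e2 a c ac b d bd := fun h => by rw [h] at h2'; exact lt_irrefl _ h2'
  have hc : sg k a c * sg k b d ≠ 0 := mul_ne_zero (sg_ne _ _ _) (sg_ne _ _ _)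
  refine hw (initForm w (plu k a b c d ab ac ad bc bd cd))
    (Ideal.subset_span ⟨_, plu_mem k a b c d ab ac ad bc bd cd, rfl⟩)
    ⟨e2 a c ac b d bd, sg k a c * sg k b d, hc, ?_⟩
  have hce : coeff (e2 a c ac b d bd) (plu k a b c d ab ac ad bc bd cd) = sg k a c * sg k b d := by
    simp [plu, coeff_monomial, n1, n2]
  have hsupp : ∀ x ∈ (plu k a b c d ab ac ad bc bd cd).support,
      x = e2 a c ac b d bd ∨ x = e2 a b ab c d cd ∨ x = e2 a d ad b c bc := by
    intro x hx
    by_contra hcon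
    push Not at hcon
    rw [mem_support_iff] at hx
    apply hx
    simp [plu, coeff_monomial, hcon.1.symm, hcon.2.1.symm, hcon.2.2.symm]
  ext x
  rw [coeff_initForm, coeff_monomial]
  by_cases hx : e2 a c ac b d bd = x
  · subst hx
    rw [if_pos, if_pos rfl, hce]
    intro y hy
    rcases hsupp y hy with rfl | rfl | rfl
    exacts [le_rfl, h1'.le, h2'.le]
  · rw [if_neg hx]
    split_ifs with h
    · by_contra h0
      have := h (e2 a c ac b d bd) (by rw [mem_support_iff, hce]; exact hc)
      rcases hsupp x (mem_support_iff.2 h0) with rfl | rfl | rfl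
      · exact hx rfl
      · exact absurd this (not_le.2 h1')
      · exact absurd this (not_le.2 h2')
    · rfl

/-- Ordering of ultrametrics. -/
lemma ultra_order {α : Type*} (u : α → α → ℝ) (hs : ∀ x y, u x y = u y x) (N : ℕ) :
    ∀ (S : Finset α), S.card ≤ N →
    (∀ x ∈ S, ∀ y ∈ S, ∀ z ∈ S, x ≠ y → x ≠ z → y ≠ z → u x z ≤ u x y ∨ u y z ≤ u x y) →
    ∃ ρ : α → ℕ, Set.InjOn ρ S ∧ ∀ x ∈ S, ∀ y ∈ S, ∀ z ∈ S, ρ x < ρ y → ρ y < ρ z →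
      u x z ≤ u x y ∧ u x z ≤ u y z := by
  induction N with
  | zero =>
    intro S hS _
    have : S = ∅ := Finset.card_eq_zero.1 (by omega)
    subst this
    exact ⟨fun _ => 0, by simp, by simp⟩
  | succ N ih =>
    intro S hS hu
    by_cases hne : S.offDiag.Nonempty
    swap
    · refine ⟨fun _ => 0, ?_, ?_⟩
      · intro x hx y hy _
        by_contra hxy
        exact hne ⟨(x, y), Finset.mem_offDiag.2 ⟨hx, hy, hxy⟩⟩
      · intro x _ y _ z _ h; simp at h
    obtain ⟨⟨a, b⟩, hab, hmin⟩ := S.offDiag.exists_min_image (fun p => u p.1 p.2) hne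
    rw [Finset.mem_offDiag] at hab
    simp only at hab hmin
    obtain ⟨haS, hbS, hab⟩ := hab
    have hmin' : ∀ x ∈ S, ∀ y ∈ S, x ≠ y → u a b ≤ u x y := fun x hx y hy hxy =>
      hmin (x, y) (Finset.mem_offDiag.2 ⟨hx, hy, hxy⟩)
    set A := S.filter (fun x => x = a ∨ u a b < u a x) with hA
    set B := S.filter (fun x => ¬ (x = a ∨ u a b < u a x)) with hB
    have hcard : A.card + B.card = S.card := Finset.card_filter_add_card_filter_not _
    have haA : a ∈ A := by simp [hA, haS]
    have hbB : b ∈ B := by simp [hB, hbS, hab.symm]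
    have hA1 := Finset.card_pos.2 ⟨a, haA⟩
    have hB1 := Finset.card_pos.2 ⟨b, hbB⟩
    have hAS : ∀ x ∈ A, x ∈ S := fun x hx => (Finset.mem_filter.1 hx).1
    have hBS : ∀ x ∈ B, x ∈ S := fun x hx => (Finset.mem_filter.1 hx).1
    have hBA : ∀ x ∈ S, x ∉ A → x ∈ B := fun x hx h => by
      rw [hB, Finset.mem_filter]; exact ⟨hx, fun h' => h (Finset.mem_filter.2 ⟨hx, h'⟩)⟩
    have hcross : ∀ x ∈ A, ∀ y ∈ B, u x y ≤ u a b := by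
      intro x hx y hy
      rw [hA, Finset.mem_filter] at hx
      rw [hB, Finset.mem_filter] at hy
      obtain ⟨hyS, hy⟩ := hy
      push Not at hy
      rcases hx with ⟨hxS, hx⟩
      by_cases hxa : x = a
      · subst hxa; exact hy.2
      · have hx' := hx.resolve_left hxa
        have hxy : x ≠ y := by rintro rfl; exact absurd hx' (not_lt.2 hy.2)
        rcases hu a haS y hyS x hxS (Ne.symm hy.1) (Ne.symm hxa) hxy.symm with h | h
        · linarith [hy.2]
        · rw [hs x y]; linarith [hy.2]
    obtain ⟨ρ1, hi1, hp1⟩ := ih A (by omega) (fun x hx y hy z hz => hu x (hAS x hx) y (hAS y hy) z (hAS z hz))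
    obtain ⟨ρ2, hi2, hp2⟩ := ih B (by omega) (fun x hx y hy z hz => hu x (hBS x hx) y (hBS y hy) z (hBS z hz))
    set K := A.sup ρ1 + 1 with hK
    have hlt : ∀ x ∈ A, ρ1 x < K := fun x hx => Nat.lt_succ_of_le (Finset.le_sup hx)
    refine ⟨fun x => if x ∈ A then ρ1 x else ρ2 x + K, ?_, ?_⟩
    · intro x hx y hy hxy
      simp only at hxy
      by_cases hxA : x ∈ A <;> by_cases hyA : y ∈ A
      · rw [if_pos hxA, if_pos hyA] at hxy
        exact hi1 hxA hyA hxy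
      · rw [if_pos hxA, if_neg hyA] at hxy
        have := hlt x hxA; omega
      · rw [if_neg hxA, if_pos hyA] at hxy
        have := hlt y hyA; omega
      · rw [if_neg hxA, if_neg hyA] at hxy
        exact hi2 (hBA x hx hxA) (hBA y hy hyA) (by omega)
    · intro x hx y hy z hz hxy hyz
      have hnxy : x ≠ y := by rintro rfl; exact lt_irrefl _ hxy
      have hnyz : y ≠ z := by rintro rfl; exact lt_irrefl _ hyz
      simp only at hxy hyz
      by_cases hxA : x ∈ A <;> by_cases hzA : z ∈ A
      · have hyA : y ∈ A := by
          by_contra h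
          rw [if_neg h, if_pos hzA] at hyz
          have := hlt z hzA; omega
        rw [if_pos hxA, if_pos hyA] at hxy
        rw [if_pos hyA, if_pos hzA] at hyz
        exact hp1 x hxA y hyA z hzA hxy hyz
      · have := hcross x hxA z (hBA z hz hzA)
        exact ⟨this.trans (hmin' _ hx _ hy hnxy), this.trans (hmin' _ hy _ hz hnyz)⟩
      · exfalso
        have h3 := hxy.trans hyz
        rw [if_neg hxA, if_pos hzA] at h3
        have := hlt z hzA; omega
      · have hyA : y ∉ A := by
          intro h
          rw [if_neg hxA, if_pos h] at hxy
          have := hlt y h; omega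
        rw [if_neg hxA, if_neg hyA] at hxy
        rw [if_neg hyA, if_neg hzA] at hyz
        exact hp2 x (hBA x hx hxA) y (hBA y hy hyA) z (hBA z hz hzA) (by omega) (by omega)

lemma permWeight_pr (π : Equiv.Perm (Fin n)) (w : Edge n → ℝ) (i j : Fin n) (h : i ≠ j) :
    permWeight π w (pr i j h) = w (pr (π i) (π j) (π.injective.ne h)) := by
  unfold permWeight pr
  congr 1
  apply Subtype.ext
  simp [Finset.image_insert]

lemma exists_perm (k : Type) [Field k] (hn : 4 ≤ n) (w : Edge n → ℝ)
    (hw : MonomialFree (initIdeal w (pluckerIdeal k 2 n))) :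
    ∃ π : Equiv.Perm (Fin n), ∀ (a b c d : Fin n) (ab : a < b) (bc : b < c) (cd : c < d),
      permWeight π w (pr a c (ab.trans bc).ne) + permWeight π w (pr b d (bc.trans cd).ne)
        ≤ permWeight π w (pr a b ab.ne) + permWeight π w (pr c d cd.ne) ∧
      permWeight π w (pr a c (ab.trans bc).ne) + permWeight π w (pr b d (bc.trans cd).ne)
        ≤ permWeight π w (pr a d ((ab.trans bc).trans cd).ne) + permWeight π w (pr b c bc.ne) := by
  set W : Fin n → Fin n → ℝ := fun i j => if h : i ≠ j then w (pr i j h) else 0 with hW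
  have hWs : ∀ i j, W i j = W j i := by
    intro i j
    by_cases h : i = j
    · rw [h]
    · simp only [hW, ne_eq, h, Ne.symm h, not_false_eq_true, dif_pos]
      rw [pr_comm]
  have hWe : ∀ i j (h : i ≠ j), W i j = w (pr i j h) := by
    intro i j h; simp only [hW]; rw [dif_pos h]
  let r : Fin n := ⟨0, by omega⟩
  set u : Fin n → Fin n → ℝ := fun i j => W i j - W i r - W j r with hu
  have hus : ∀ i j, u i j = u j i := by intro i j; simp only [hu]; rw [hWs i j]; ring
  obtain ⟨ρ, hinj, hρ⟩ := ultra_order u hus (Finset.univ.erase r).card (Finset.univ.erase r) le_rfl (by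
    intro x hx y hy z hz xy xz yz
    have hxr := Finset.ne_of_mem_erase hx
    have hyr := Finset.ne_of_mem_erase hy
    have hzr := Finset.ne_of_mem_erase hz
    by_contra hcon
    push Not at hcon
    obtain ⟨c1, c2⟩ := hcon
    simp only [hu] at c1 c2
    apply four_point k w hw x z y r xz xy hxr yz.symm hzr hyr
    · rw [← hWe, ← hWe, ← hWe, ← hWe]; linarith
    · rw [← hWe, ← hWe, ← hWe, ← hWe]; rw [hWs z y]; linarith)
  set K := Finset.univ.sup ρ + 1 with hK
  have hlt : ∀ x, ρ x < K := fun x => Nat.lt_succ_of_le (Finset.le_sup (Finset.mem_univ x))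
  set τ : Fin n → ℕ := fun x => if x = r then K else ρ x with hτ
  have hτr : ∀ x, x ≠ r → τ x = ρ x := fun x hx => by simp [hτ, hx]
  have hτlt : ∀ x y, τ x < τ y → x ≠ r := by
    rintro x y h rfl
    simp only [hτ, if_true] at h
    split_ifs at h
    · omega
    · have := hlt y; omega
  have hτinj : Function.Injective τ := by
    intro x y hxy
    simp only [hτ] at hxy
    split_ifs at hxy with h1 h2 h2
    · rw [h1, h2]
    · have := hlt y; omega
    · have := hlt x; omega
    · exact hinj (by simp [h1]) (by simp [h2]) hxy
  have hsm : StrictMono (τ ∘ Tuple.sort τ) :=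
    (Tuple.monotone_sort τ).strictMono_of_injective (hτinj.comp (Tuple.sort τ).injective)
  refine ⟨Tuple.sort τ, ?_⟩
  intro a b c d ab bc cd
  simp only [permWeight_pr, ← hWe]
  have h1 := hsm ab
  have h2 := hsm bc
  have h3 := hsm cd
  simp only [Function.comp] at h1 h2 h3
  generalize Tuple.sort τ a = A at *
  generalize Tuple.sort τ b = B at *
  generalize Tuple.sort τ c = C at *
  generalize Tuple.sort τ d = D at *
  have hA := hτlt _ _ h1
  have hB := hτlt _ _ h2
  have hC := hτlt _ _ h3
  have mem : ∀ x, x ≠ r → x ∈ Finset.univ.erase r := fun x hx => by simp [hx]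
  have key : ∀ x y z, z ≠ r → τ x < τ y → τ y < τ z → u x z ≤ u x y ∧ u x z ≤ u y z := by
    intro x y z hz hxy hyz
    have hx := hτlt _ _ hxy
    have hy := hτlt _ _ hyz
    rw [hτr x hx, hτr y hy] at hxy
    rw [hτr z hz, hτr y hy] at hyz
    exact hρ x (mem x hx) y (mem y hy) z (mem z hz) hxy hyz
  have k1 := key A B C hC h1 h2
  by_cases hD : D = r
  · subst hD
    simp only [hu] at k1
    constructor <;> linarith [k1.1, k1.2]
  · have k2 := key B C D hD h2 h3
    have k3 := key A B D hD h1 (h2.trans h3)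
    have k4 := key A C D hD (h1.trans h2) h3
    have hul : ∀ x ∈ ({A, B, C, D} : Finset (Fin n)), x ≠ r := by simp [hA, hB, hC, hD]
    have k5 : u A C ≤ u A D ∨ u C D ≤ u A D := by
      by_contra hcon
      push Not at hcon
      obtain ⟨c1, c2⟩ := hcon
      simp only [hu] at c1 c2
      have ne : ∀ x y, τ x < τ y → x ≠ y := by rintro x y h rfl; exact lt_irrefl _ h
      have nAC := ne _ _ (h1.trans h2)
      have nAD := ne _ _ ((h1.trans h2).trans h3)
      have nCD := ne _ _ h3
      apply four_point k w hw A C D r nAC nAD hA nCD hC hD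
      · rw [← hWe, ← hWe, ← hWe, ← hWe]; linarith
      · rw [← hWe, ← hWe, ← hWe, ← hWe]; linarith
    have goal1 : u A C + u B D ≤ u A B + u C D := by linarith [k1.1, k2.2]
    have goal2 : u A C + u B D ≤ u A D + u B C := by
      rcases k5 with h | h
      · linarith [k2.1]
      · linarith [k1.2, k2.2]
    simp only [hu] at goal1 goal2
    constructor <;> linarith

lemma initIdeal_component {σ : Type*} {k : Type*} [CommRing k] (w : σ → ℝ)
    (I : Ideal (MvPolynomial σ k)) (g : MvPolynomial σ k) (hg : g ∈ initIdeal w I) :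
    ∀ W : ℝ, ∃ f ∈ I, (∀ b, expWeight w b < W → coeff b f = 0) ∧
      (∀ b, expWeight w b = W → coeff b f = coeff b g) := by
  unfold initIdeal at hg
  induction hg using Submodule.span_induction with
  | mem x hx =>
    obtain ⟨f, hf, rfl⟩ := hx
    intro W
    by_cases h : ∃ b ∈ f.support, expWeight w b = W ∧ ∀ c ∈ f.support, expWeight w b ≤ expWeight w c
    · obtain ⟨b, hb, rfl, hmin⟩ := h
      refine ⟨f, hf, ?_, ?_⟩
      · intro c hc
        by_contra h0
        exact absurd (hmin c (mem_support_iff.2 h0)) (not_le.2 hc)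
      · intro c hc
        rw [coeff_initForm, if_pos]
        rw [hc]; exact hmin
    · refine ⟨0, I.zero_mem, by simp, ?_⟩
      intro b hb
      rw [coeff_initForm]
      split_ifs with h1
      · by_contra h0
        exact h ⟨b, mem_support_iff.2 (fun h2 => h0 (by simp [h2])), hb, h1⟩
      · simp
  | zero => intro W; exact ⟨0, I.zero_mem, by simp, by simp⟩
  | add x y _ _ hx hy =>
    intro W
    obtain ⟨f, hf, f1, f2⟩ := hx W
    obtain ⟨g, hg, g1, g2⟩ := hy W
    refine ⟨f + g, I.add_mem hf hg, ?_, ?_⟩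
    · intro b hb; rw [coeff_add, f1 b hb, g1 b hb, add_zero]
    · intro b hb; rw [coeff_add, coeff_add, f2 b hb, g2 b hb]
  | smul r x _ hx =>
    rw [smul_eq_mul]
    induction r using MvPolynomial.induction_on' with
    | monomial m c =>
      intro W
      obtain ⟨f, hf, f1, f2⟩ := hx (W - expWeight w m)
      have hsub : ∀ b, m ≤ b → expWeight w (b - m) = expWeight w b - expWeight w m := by
        intro b hb
        have := expWeight_add w (b - m) m
        rw [tsub_add_cancel_of_le hb] at this
        linarith
      refine ⟨monomial m c * f, I.mul_mem_left _ hf, ?_, ?_⟩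
      · intro b hb
        rw [coeff_monomial_mul']
        split_ifs with h
        · rw [f1 _ (by rw [hsub b h]; linarith), mul_zero]
        · rfl
      · intro b hb
        rw [coeff_monomial_mul', coeff_monomial_mul']
        split_ifs with h
        · rw [f2 _ (by rw [hsub b h]; linarith)]
        · rfl
    | add p q hp hq =>
      intro W
      obtain ⟨f, hf, f1, f2⟩ := hp W
      obtain ⟨g, hg, g1, g2⟩ := hq W
      rw [add_mul]
      refine ⟨f + g, I.add_mem hf hg, ?_, ?_⟩
      · intro b hb; rw [coeff_add, f1 b hb, g1 b hb, add_zero]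
      · intro b hb; rw [coeff_add, coeff_add, f2 b hb, g2 b hb]

noncomputable def anyMO (σ : Type) [Finite σ] : MonomialOrder σ :=
  letI : LinearOrder σ := LinearOrder.lift' (Finite.equivFin σ) (Finite.equivFin σ).injective
  MonomialOrder.lex

noncomputable def wOrder {σ : Type} [Finite σ] (v : σ → ℕ) : MonoOrder σ :=
  let key : (σ →₀ ℕ) → ℕ ×ₗ (anyMO σ).syn := fun a => toLex (Finsupp.weight v a, (anyMO σ).toSyn a)
  have hk : Function.Injective key := fun a b h => by
    have := congrArg (fun x => (ofLex x).2) h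
    exact (anyMO σ).toSyn.injective this
  { lt := fun a b => key a < key b
    trichot := fun a b => by
      rcases lt_trichotomy (key a) (key b) with h | h | h
      · exact Or.inl h
      · exact Or.inr (Or.inl (hk h))
      · exact Or.inr (Or.inr h)
    trans := fun a b c h1 h2 => lt_trans h1 h2
    irrefl := fun a => lt_irrefl _
    add_right := fun a b c h => by
      simp only [key, Prod.Lex.toLex_lt_toLex, map_add] at h ⊢
      rcases h with h | ⟨h1, h2⟩
      · exact Or.inl (by omega)
      · exact Or.inr ⟨by omega, by simpa using h2⟩
    wf := InvImage.wf key wellFounded_lt }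

lemma wOrder_lt {σ : Type} [Finite σ] (v : σ → ℕ) (a b : σ →₀ ℕ)
    (h : Finsupp.weight v a < Finsupp.weight v b) : (wOrder v).lt a b := by
  change toLex (Finsupp.weight v a, (anyMO σ).toSyn a) < toLex (Finsupp.weight v b, (anyMO σ).toSyn b)
  rw [Prod.Lex.toLex_lt_toLex]
  exact Or.inl h

noncomputable def uu (S : Edge n) : ℕ := ((hi S : ℕ) - lo S) * (n - ((hi S : ℕ) - lo S))

noncomputable def vv (S : Edge n) : ℕ := n * n - uu S

lemma uu_le (S : Edge n) : uu S ≤ n * n := by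
  unfold uu
  apply Nat.mul_le_mul <;> omega

lemma uu_pr {i j : Fin n} (h : i < j) (h' : i ≠ j) :
    (uu (pr i j h') : ℤ) = ((j : ℤ) - i) * (n - ((j : ℤ) - i)) := by
  unfold uu
  rw [lo_pr h, hi_pr h]
  have h1 : (i : ℕ) < j := h
  have h2 := j.2
  rw [Nat.cast_mul, Nat.cast_sub (by omega : (j : ℕ) - i ≤ n), Nat.cast_sub h1.le]

lemma uu_cross {a b c d : Fin n} (ab : a < b) (bc : b < c) (cd : c < d) :
    uu (pr a b ab.ne) + uu (pr c d cd.ne) <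
      uu (pr a c (ab.trans bc).ne) + uu (pr b d (bc.trans cd).ne) ∧
    uu (pr a d ((ab.trans bc).trans cd).ne) + uu (pr b c bc.ne) <
      uu (pr a c (ab.trans bc).ne) + uu (pr b d (bc.trans cd).ne) := by
  zify
  rw [uu_pr ab, uu_pr cd, uu_pr (ab.trans bc), uu_pr (bc.trans cd),
    uu_pr ((ab.trans bc).trans cd), uu_pr bc]
  have hd := d.2
  have h1 : ((a : ℕ) : ℤ) < (b : ℕ) := by exact_mod_cast ab
  have h2 : ((b : ℕ) : ℤ) < (c : ℕ) := by exact_mod_cast bc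
  have h3 : ((c : ℕ) : ℤ) < (d : ℕ) := by exact_mod_cast cd
  have h4 : ((d : ℕ) : ℤ) < n := by exact_mod_cast hd
  have h5 : (0 : ℤ) ≤ (a : ℕ) := by positivity
  generalize ((a : ℕ) : ℤ) = A at *
  generalize ((b : ℕ) : ℤ) = B at *
  generalize ((c : ℕ) : ℤ) = C at *
  generalize ((d : ℕ) : ℤ) = D at *
  generalize (n : ℤ) = N at *
  constructor
  · have : 0 < (C - B) * (N - (D - A)) := mul_pos (by linarith) (by linarith)
    nlinarith
  · have : 0 < (B - A) * (D - C) := mul_pos (by linarith) (by linarith)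
    nlinarith

lemma weight_e2 (v : Edge n → ℕ) (i j : Fin n) (h : i ≠ j) (l m : Fin n) (h' : l ≠ m) :
    Finsupp.weight v (e2 i j h l m h') = v (pr i j h) + v (pr l m h') := by
  simp [e2, Finsupp.weight_single]

lemma expWeight_e2 (w : Edge n → ℝ) (i j : Fin n) (h : i ≠ j) (l m : Fin n) (h' : l ≠ m) :
    expWeight w (e2 i j h l m h') = w (pr i j h) + w (pr l m h') := by
  simp [e2, expWeight_add, expWeight_single]

lemma lt_cross {a b c d : Fin n} (ab : a < b) (bc : b < c) (cd : c < d) :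
    (wOrder vv).lt (e2 a c (ab.trans bc).ne b d (bc.trans cd).ne) (e2 a b ab.ne c d cd.ne) ∧
    (wOrder vv).lt (e2 a c (ab.trans bc).ne b d (bc.trans cd).ne)
      (e2 a d ((ab.trans bc).trans cd).ne b c bc.ne) := by
  have h := uu_cross ab bc cd
  have h1 := uu_le (pr a c (ab.trans bc).ne)
  have h2 := uu_le (pr b d (bc.trans cd).ne)
  have h3 := uu_le (pr a b ab.ne)
  have h4 := uu_le (pr c d cd.ne)
  have h5 := uu_le (pr a d ((ab.trans bc).trans cd).ne)
  have h6 := uu_le (pr b c bc.ne)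
  constructor <;> apply wOrder_lt <;> rw [weight_e2, weight_e2] <;> unfold vv <;> omega

def NonCross (a : Edge n →₀ ℕ) : Prop :=
  ∀ (i j l m : Fin n) (hij : i < j) (hjl : j < l) (hlm : l < m),
    ¬ (e2 i l (hij.trans hjl).ne j m (hjl.trans hlm).ne ≤ a)

lemma plu_eq (k : Type*) [CommRing k] {a b c d : Fin n} (ab : a < b) (bc : b < c) (cd : c < d) :
    plu k a b c d ab.ne (ab.trans bc).ne ((ab.trans bc).trans cd).ne bc.ne (bc.trans cd).ne cd.ne
    = monomial (e2 a c (ab.trans bc).ne b d (bc.trans cd).ne) 1 - monomial (e2 a b ab.ne c d cd.ne) 1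
     - monomial (e2 a d ((ab.trans bc).trans cd).ne b c bc.ne) 1 := by
  unfold plu
  simp only [sg_lt k ab, sg_lt k bc, sg_lt k cd, sg_lt k (ab.trans bc), sg_lt k (bc.trans cd),
    sg_lt k ((ab.trans bc).trans cd), mul_one]

lemma plu_mem' (k : Type*) [CommRing k] {a b c d : Fin n} (ab : a < b) (bc : b < c) (cd : c < d) :
    (monomial (e2 a c (ab.trans bc).ne b d (bc.trans cd).ne) 1 - monomial (e2 a b ab.ne c d cd.ne) 1
     - monomial (e2 a d ((ab.trans bc).trans cd).ne b c bc.ne) 1 : MvPolynomial (Edge n) k)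
     ∈ pluckerIdeal k 2 n := by
  have h := plu_eq k ab bc cd
  rw [← h]
  apply plu_mem

def GoodW (w : Edge n → ℝ) : Prop :=
  ∀ (a b c d : Fin n) (ab : a < b) (bc : b < c) (cd : c < d),
      w (pr a c (ab.trans bc).ne) + w (pr b d (bc.trans cd).ne)
        ≤ w (pr a b ab.ne) + w (pr c d cd.ne) ∧
      w (pr a c (ab.trans bc).ne) + w (pr b d (bc.trans cd).ne)
        ≤ w (pr a d ((ab.trans bc).trans cd).ne) + w (pr b c bc.ne)

lemma crossing_le (k : Type) [Field k] (w : Edge n → ℝ) (hw : GoodW w) :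
    crossingIdeal k n ≤ ordInitIdeal (wOrder vv) (initIdeal w (pluckerIdeal k 2 n)) := by
  unfold crossingIdeal
  rw [Ideal.span_le]
  rintro g ⟨a, b, c, d, ab, bc, cd, rfl⟩
  apply Ideal.subset_span
  have hl := lt_cross ab bc cd
  have hww := hw a b c d ab bc cd
  rw [← expWeight_e2, ← expWeight_e2, ← expWeight_e2] at hww
  have hpm := plu_mem' k ab bc cd
  have hmul : (X (pr a c (ab.trans bc).ne) * X (pr b d (bc.trans cd).ne) : MvPolynomial (Edge n) k)
      = monomial (e2 a c (ab.trans bc).ne b d (bc.trans cd).ne) 1 := by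
    simp [X, monomial_mul, e2]
  rw [hmul]
  generalize e2 a c (ab.trans bc).ne b d (bc.trans cd).ne = E1 at *
  generalize e2 a b ab.ne c d cd.ne = E2 at *
  generalize e2 a d ((ab.trans bc).trans cd).ne b c bc.ne = E3 at *
  have n1 : E2 ≠ E1 := by rintro rfl; exact (wOrder vv).irrefl _ hl.1
  have n2 : E3 ≠ E1 := by rintro rfl; exact (wOrder vv).irrefl _ hl.2
  set f : MvPolynomial (Edge n) k := monomial E1 1 - monomial E2 1 - monomial E3 1 with hf
  have hce : coeff E1 f = 1 := by simp [hf, coeff_monomial, n1, n2]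
  have hsupp : ∀ x ∈ f.support, x = E1 ∨ x = E2 ∨ x = E3 := by
    intro x hx
    by_contra hcon
    push Not at hcon
    rw [mem_support_iff] at hx
    apply hx
    simp [hf, coeff_monomial, hcon.1.symm, hcon.2.1.symm, hcon.2.2.symm]
  have hci : coeff E1 (initForm w f) = 1 := by
    rw [coeff_initForm, if_pos, hce]
    intro c hc
    rcases hsupp c hc with rfl | rfl | rfl
    exacts [le_rfl, hww.1, hww.2]
  refine ⟨initForm w f, Ideal.subset_span ⟨f, hpm, rfl⟩, ?_, E1, ?_, ?_, rfl⟩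
  · intro h; rw [h] at hci; simp at hci
  · rw [mem_support_iff, hci]; exact one_ne_zero
  · intro x hx hne
    have : x ∈ f.support := by
      rw [mem_support_iff, coeff_initForm] at hx
      rw [mem_support_iff]
      intro h0; rw [h0] at hx; simp at hx
    rcases hsupp x this with rfl | rfl | rfl
    exacts [absurd rfl hne, hl.1, hl.2]

lemma normal_form (k : Type) [Field k] (w : Edge n → ℝ) (hw : GoodW w) (N : ℕ) :
    ∀ a : Edge n →₀ ℕ, Finsupp.weight uu a ≤ N →
    ∃ h : MvPolynomial (Edge n) k, monomial a 1 - h ∈ pluckerIdeal k 2 n ∧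
      ∀ b ∈ h.support, NonCross b ∧ (b = a ∨ (expWeight w a ≤ expWeight w b ∧ (wOrder vv).lt a b)) := by
  induction N using Nat.strong_induction_on with
  | _ N ih =>
  intro a ha
  by_cases hnc : NonCross a
  · refine ⟨monomial a 1, by simp, ?_⟩
    intro b hb
    have : b = a := by
      by_contra h
      rw [mem_support_iff, coeff_monomial, if_neg (Ne.symm h)] at hb
      exact hb rfl
    subst this
    exact ⟨hnc, Or.inl rfl⟩
  · unfold NonCross at hnc
    push Not at hnc
    obtain ⟨i, j, l, m, hij, hjl, hlm, hle⟩ := hnc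
    have hl := lt_cross hij hjl hlm
    have hww := hw i j l m hij hjl hlm
    rw [← expWeight_e2, ← expWeight_e2, ← expWeight_e2] at hww
    have huu := uu_cross hij hjl hlm
    rw [← weight_e2, ← weight_e2, ← weight_e2] at huu
    have hpm := plu_mem' k hij hjl hlm
    generalize e2 i l (hij.trans hjl).ne j m (hjl.trans hlm).ne = E1 at *
    generalize e2 i j hij.ne l m hlm.ne = E2 at *
    generalize e2 i m ((hij.trans hjl).trans hlm).ne j l hjl.ne = E3 at *
    obtain ⟨a', rfl⟩ : ∃ a', a = E1 + a' := ⟨a - E1, (add_tsub_cancel_of_le hle).symm⟩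
    rw [map_add] at ha
    obtain ⟨h2, p2, q2⟩ := ih (Finsupp.weight uu (E2 + a')) (by rw [map_add]; omega) _ le_rfl
    obtain ⟨h3, p3, q3⟩ := ih (Finsupp.weight uu (E3 + a')) (by rw [map_add]; omega) _ le_rfl
    refine ⟨h2 + h3, ?_, ?_⟩
    · have h4 := Ideal.mul_mem_left _ (monomial a' (1 : k)) hpm
      have h5 := Ideal.add_mem _ (Ideal.add_mem _ h4 p2) p3
      convert h5 using 1
      rw [mul_sub, mul_sub]
      simp only [monomial_mul, mul_one, add_comm a']
      ring
    · have l2 := (wOrder vv).add_right _ _ a' hl.1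
      have l3 := (wOrder vv).add_right _ _ a' hl.2
      intro b hb
      rw [expWeight_add]
      rcases Finset.mem_union.1 (support_add hb) with hb | hb
      · obtain ⟨c1, c2⟩ := q2 b hb
        refine ⟨c1, Or.inr ?_⟩
        rcases c2 with rfl | ⟨c2, c3⟩
        · exact ⟨by rw [expWeight_add]; linarith [hww.1], l2⟩
        · exact ⟨by rw [expWeight_add] at c2; linarith [hww.1], (wOrder vv).trans _ _ _ l2 c3⟩
      · obtain ⟨c1, c2⟩ := q3 b hb
        refine ⟨c1, Or.inr ?_⟩
        rcases c2 with rfl | ⟨c2, c3⟩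
        · exact ⟨by rw [expWeight_add]; linarith [hww.2], l3⟩
        · exact ⟨by rw [expWeight_add] at c2; linarith [hww.2], (wOrder vv).trans _ _ _ l3 c3⟩

lemma exists_mo (n : ℕ) : ∃ m : MonomialOrder.{0,0} (Fin 2 × Fin n), ∀ i j : Fin n, i < j →
    m.toSyn (Finsupp.single (0, j) 1 + Finsupp.single (1, i) 1) <
      m.toSyn (Finsupp.single (0, i) 1 + Finsupp.single (1, j) 1) := by
  let inst : LinearOrder (Fin 2 × Fin n) := LinearOrder.lift' finProdFinEquiv finProdFinEquiv.injective
  have := @Finite.to_wellFoundedGT (Fin 2 × Fin n) _ inst.toPartialOrder.toPreorder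
  refine ⟨@MonomialOrder.lex _ inst this, ?_⟩
  intro i j hij
  rw [MonomialOrder.lex_lt_iff]
  refine ⟨((0, i) : Fin 2 × Fin n), ?_, ?_⟩
  · intro x hx
    have hx' : finProdFinEquiv x < finProdFinEquiv ((0, i) : Fin 2 × Fin n) := hx
    rw [Fin.lt_def] at hx'
    simp only [finProdFinEquiv_apply_val] at hx'
    obtain ⟨x1, x2⟩ := x
    have hi := i.2
    have hij' : (i : ℕ) < j := hij
    fin_cases x1
    · simp at hx'
      have h1 : x2 ≠ i := by rintro rfl; omega
      have h2 : x2 ≠ j := by rintro rfl; omega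
      simp [Finsupp.single_apply, h1.symm, h2.symm]
    · simp at hx'
      omega
  · have h1 : ((0, j) : Fin 2 × Fin n) ≠ (0, i) := by simp [hij.ne']
    simp [Finsupp.single_apply, hij.ne']

noncomputable def LL : (Edge n →₀ ℕ) →+ (Fin 2 × Fin n →₀ ℕ) :=
  Finsupp.weight (fun S : Edge n => Finsupp.single ((0 : Fin 2), lo S) 1 + Finsupp.single ((1 : Fin 2), hi S) 1)

lemma LL_single (S : Edge n) (c : ℕ) : LL (Finsupp.single S c) =
    c • (Finsupp.single ((0 : Fin 2), lo S) 1 + Finsupp.single ((1 : Fin 2), hi S) 1) := by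
  rw [LL, Finsupp.weight_single]

lemma LL_pos (a : Edge n →₀ ℕ) (r : Fin 2) (v : Fin n) :
    0 < LL a (r, v) ↔ ∃ S, 0 < a S ∧ (if r = 0 then lo S else hi S) = v := by
  have : LL a (r, v) = ∑ S, a S * (if (if r = 0 then lo S else hi S) = v then 1 else 0) := by
    rw [LL, Finsupp.weight_eq_sum, Finsupp.finsetSum_apply]
    refine Finset.sum_congr rfl fun S _ => ?_
    fin_cases r <;> simp [Finsupp.single_apply]
  rw [this, Finset.sum_pos_iff]
  constructor
  · rintro ⟨S, _, h⟩
    by_cases hv : (if r = 0 then lo S else hi S) = v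
    · exact ⟨S, by simpa [hv] using h, hv⟩
    · simp [hv] at h
  · rintro ⟨S, h, hv⟩
    exact ⟨S, Finset.mem_univ _, by simpa [hv] using h⟩

lemma LL_pos0 (a : Edge n →₀ ℕ) (v : Fin n) : 0 < LL a (0, v) ↔ ∃ S, 0 < a S ∧ lo S = v := by
  simpa using LL_pos a 0 v

lemma LL_pos1 (a : Edge n →₀ ℕ) (v : Fin n) : 0 < LL a (1, v) ↔ ∃ S, 0 < a S ∧ hi S = v := by
  simpa using LL_pos a 1 v

lemma NonCross.mono {a b : Edge n →₀ ℕ} (hb : NonCross b) (h : a ≤ b) : NonCross a :=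
  fun i j l m hij hjl hlm h' => hb i j l m hij hjl hlm (h'.trans h)

lemma e2_le {a : Edge n →₀ ℕ} (i j : Fin n) (h : i ≠ j) (l m : Fin n) (h' : l ≠ m)
    (hne : pr i j h ≠ pr l m h') (h1 : 0 < a (pr i j h)) (h2 : 0 < a (pr l m h')) :
    e2 i j h l m h' ≤ a := by
  intro S
  simp only [e2, Finsupp.add_apply, Finsupp.single_apply]
  split_ifs with c1 c2 c2
  · exact absurd (c1.trans c2.symm) hne
  · subst c1; omega
  · subst c2; omega
  · omega

lemma forced_edge (c : Edge n →₀ ℕ) (hc : NonCross c) (i j : Fin n) (hij : i < j)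
    (hj : 0 < LL c (1, j)) (hjmin : ∀ v, 0 < LL c (1, v) → j ≤ v)
    (hi0 : 0 < LL c (0, i)) (himax : ∀ v, v < j → 0 < LL c (0, v) → v ≤ i) :
    0 < c (pr i j hij.ne) := by
  obtain ⟨S, hS, hSj⟩ := (LL_pos1 c j).1 hj
  obtain ⟨T, hT, hTi⟩ := (LL_pos0 c i).1 hi0
  have hSl := lo_lt_hi S
  have hTl := lo_lt_hi T
  have eS := pr_lo_hi S
  have eT := pr_lo_hi T
  have h1 : lo S ≤ i := himax _ (hSj ▸ hSl) ((LL_pos0 c _).2 ⟨S, hS, rfl⟩)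
  have h2 : j ≤ hi T := hjmin _ ((LL_pos1 c _).2 ⟨T, hT, rfl⟩)
  rcases h1.eq_or_lt with h1 | h1
  · subst hSj h1; rw [eS]; exact hS
  rcases h2.eq_or_lt with h2 | h2
  · subst hTi h2; rw [eT]; exact hT
  exfalso
  subst hTi hSj
  refine hc (lo S) (lo T) (hi S) (hi T) h1 hij h2 (e2_le _ _ _ _ _ _ ?_ ?_ ?_)
  · rw [eS, eT]; rintro rfl; exact lt_irrefl _ h1
  · rw [eS]; exact hS
  · rw [eT]; exact hT

lemma LL_inj (N : ℕ) : ∀ a b : Edge n →₀ ℕ, a.degree ≤ N → NonCross a → NonCross b → LL a = LL b →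
    a = b := by
  induction N with
  | zero =>
    intro a b ha _ _ hab
    have ha0 : a = 0 := (Finsupp.degree_eq_zero_iff a).1 (by omega)
    subst ha0
    symm
    ext S
    by_contra h
    have := (LL_pos0 b (lo S)).2 ⟨S, Nat.pos_of_ne_zero h, rfl⟩
    rw [← hab] at this
    simp at this
  | succ N ih =>
    intro a b ha hna hnb hab
    by_cases ha0 : a = 0
    · subst ha0
      symm
      ext S
      by_contra h
      have := (LL_pos0 b (lo S)).2 ⟨S, Nat.pos_of_ne_zero h, rfl⟩
      rw [← hab] at this
      simp at this
    obtain ⟨S, hS⟩ := Finsupp.ne_iff.1 ha0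
    have hS : 0 < a S := Nat.pos_of_ne_zero hS
    obtain ⟨j, hj, hjmin⟩ := (Finset.univ.filter (fun v : Fin n => 0 < LL a (1, v))).exists_min_image id
      ⟨hi S, by simpa using (LL_pos1 a (hi S)).2 ⟨S, hS, rfl⟩⟩
    simp only [Finset.mem_filter, Finset.mem_univ, true_and, id] at hj hjmin
    obtain ⟨T, hT, hTj⟩ := (LL_pos1 a j).1 hj
    obtain ⟨i, hi, himax⟩ := (Finset.univ.filter (fun v : Fin n => v < j ∧ 0 < LL a (0, v))).exists_max_image id
      ⟨lo T, by simpa using ⟨hTj ▸ lo_lt_hi T, (LL_pos0 a (lo T)).2 ⟨T, hT, rfl⟩⟩⟩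
    simp only [Finset.mem_filter, Finset.mem_univ, true_and, id] at hi himax
    have f1 := forced_edge a hna i j hi.1 hj hjmin hi.2 (fun v h1 h2 => himax v ⟨h1, h2⟩)
    rw [hab] at hj hjmin hi himax
    have f2 := forced_edge b hnb i j hi.1 hj hjmin hi.2 (fun v h1 h2 => himax v ⟨h1, h2⟩)
    generalize pr i j hi.1.ne = E at f1 f2
    obtain ⟨a', rfl⟩ : ∃ a', a = Finsupp.single E 1 + a' :=
      ⟨a - Finsupp.single E 1, (add_tsub_cancel_of_le (by simpa using Nat.succ_le_of_lt f1)).symm⟩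
    obtain ⟨b', rfl⟩ : ∃ b', b = Finsupp.single E 1 + b' :=
      ⟨b - Finsupp.single E 1, (add_tsub_cancel_of_le (by simpa using Nat.succ_le_of_lt f2)).symm⟩
    rw [map_add, map_add] at hab
    rw [map_add, Finsupp.degree_single] at ha
    rw [ih a' b' (by omega) (hna.mono le_add_self) (hnb.mono le_add_self) (add_left_cancel hab)]

lemma degree_plucker (k : Type) [Field k] (m : MonomialOrder (Fin 2 × Fin n))
    (hm : ∀ i j : Fin n, i < j →
      m.toSyn (Finsupp.single (0, j) 1 + Finsupp.single (1, i) 1) <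
        m.toSyn (Finsupp.single (0, i) 1 + Finsupp.single (1, j) 1)) (a : Edge n →₀ ℕ) :
    pluckerMap k 2 n (monomial a 1) ≠ 0 ∧ m.degree (pluckerMap k 2 n (monomial a 1)) = LL a := by
  induction a using Finsupp.induction_linear with
  | zero =>
    have : (monomial (0 : Edge n →₀ ℕ) (1 : k)) = 1 := rfl
    rw [this, map_one, map_zero]
    exact ⟨one_ne_zero, m.degree_one⟩
  | add a b ha hb =>
    have : (monomial (a + b) (1 : k)) = monomial a 1 * monomial b 1 := by simp [monomial_mul]
    rw [this, map_mul, map_add, m.degree_mul ha.1 hb.1, ha.2, hb.2]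
    exact ⟨mul_ne_zero ha.1 hb.1, rfl⟩
  | single S c =>
    have hd : ∀ x y : Fin 2 × Fin n, m.degree (X x * X y : MvPolynomial (Fin 2 × Fin n) k)
        = Finsupp.single x 1 + Finsupp.single y 1 := by
      intro x y
      rw [m.degree_mul (X_ne_zero _) (X_ne_zero _), m.degree_X, m.degree_X]
    have h1 : m.degree (pluckerMap k 2 n (X S)) =
        Finsupp.single ((0 : Fin 2), lo S) 1 + Finsupp.single ((1 : Fin 2), hi S) 1 := by
      rw [pluckerMap_X, m.degree_sub_of_lt, hd]
      rw [hd, hd]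
      exact hm _ _ (lo_lt_hi S)
    have h2 : pluckerMap k 2 n (X S) ≠ 0 := by
      apply m.ne_zero_of_degree_ne_zero
      rw [h1]
      intro h
      have := DFunLike.congr_fun h ((0 : Fin 2), lo S)
      simp at this
    rw [← X_pow_eq_monomial, map_pow, m.degree_pow, h1, LL_single]
    exact ⟨pow_ne_zero _ h2, rfl⟩

lemma noncross_indep (k : Type) [Field k] (F : MvPolynomial (Edge n) k)
    (hF : F ∈ pluckerIdeal k 2 n) (hnc : ∀ b ∈ F.support, NonCross b) : F = 0 := by
  by_contra h0
  obtain ⟨m, hm⟩ := exists_mo n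
  have hd := degree_plucker k m hm
  obtain ⟨b0, hb0, hmax⟩ := F.support.exists_max_image (fun b => m.toSyn (LL b)) (support_nonempty.2 h0)
  rw [pluckerIdeal, RingHom.mem_ker] at hF
  have hsum : pluckerMap k 2 n F = ∑ b ∈ F.support, C (coeff b F) * pluckerMap k 2 n (monomial b 1) := by
    conv_lhs => rw [F.as_sum]
    rw [map_sum]
    refine Finset.sum_congr rfl fun b _ => ?_
    have : monomial b (coeff b F) = C (coeff b F) * monomial b 1 := by simp [C_mul_monomial]
    rw [this, map_mul]
    congr 1
    exact (pluckerMap k 2 n).commutes _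
  have hF' : pluckerMap k 2 n F = 0 := hF
  have hc := congrArg (coeff (LL b0)) (hsum.symm.trans hF')
  rw [coeff_sum, coeff_zero, Finset.sum_eq_single b0] at hc
  · rw [coeff_C_mul] at hc
    rcases mul_eq_zero.1 hc with h | h
    · exact (mem_support_iff.1 hb0) h
    · rw [← (hd b0).2, m.coeff_degree_eq_zero_iff] at h
      exact (hd b0).1 h
  · intro b hb hne
    rw [coeff_C_mul, m.coeff_eq_zero_of_lt, mul_zero]
    rw [(hd b).2]
    refine lt_of_le_of_ne (hmax b hb) fun h => hne ?_
    exact LL_inj _ b b0 le_rfl (hnc b hb) (hnc b0 hb0) (m.toSyn.injective h)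
  · intro h; exact absurd hb0 h

lemma le_crossing (k : Type) [Field k] (w : Edge n → ℝ) (hw : GoodW w) :
    ordInitIdeal (wOrder vv) (initIdeal w (pluckerIdeal k 2 n)) ≤ crossingIdeal k n := by
  unfold ordInitIdeal
  rw [Ideal.span_le]
  rintro _ ⟨g, hg, -, a, ha, hmin, rfl⟩
  by_cases hnc : NonCross a
  · exfalso
    obtain ⟨f, hf, f1, f2⟩ := initIdeal_component w _ g hg (expWeight w a)
    choose h hI hS using fun a => normal_form k w hw _ a le_rfl
    set F := ∑ b ∈ f.support, C (coeff b f) * h b with hFdef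
    have hFI : F ∈ pluckerIdeal k 2 n := by
      have : f - F ∈ pluckerIdeal k 2 n := by
        have e : f - F = ∑ b ∈ f.support, C (coeff b f) * (monomial b 1 - h b) := by
          conv_lhs => rw [f.as_sum]
          rw [hFdef, ← Finset.sum_sub_distrib]
          refine Finset.sum_congr rfl fun b _ => ?_
          rw [mul_sub, C_mul_monomial, mul_one]
        rw [e]
        exact Ideal.sum_mem _ fun b _ => Ideal.mul_mem_left _ _ (hI b)
      have := Ideal.sub_mem _ hf this
      rwa [sub_sub_cancel] at this
    have hF0 : F = 0 := by
      apply noncross_indep k F hFI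
      intro b hb
      by_contra hn
      rw [mem_support_iff] at hb
      apply hb
      rw [hFdef, coeff_sum]
      refine Finset.sum_eq_zero fun c _ => ?_
      rw [coeff_C_mul]
      by_cases hz : coeff b (h c) = 0
      · rw [hz, mul_zero]
      · exact absurd (hS c b (mem_support_iff.2 hz)).1 hn
    have hfa : coeff a f ≠ 0 := by rw [f2 a rfl]; exact mem_support_iff.1 ha
    have hha : coeff a (h a) ≠ 0 := by
      have : monomial a 1 - h a = 0 := by
        apply noncross_indep k _ (hI a)
        intro b hb
        rcases Finset.mem_union.1 (support_sub _ _ _ hb) with h' | h'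
        · have := support_monomial_subset h'
          rw [Finset.mem_singleton] at this
          rw [this]; exact hnc
        · exact (hS a b h').1
      rw [← sub_eq_zero.1 this, coeff_monomial, if_pos rfl]
      exact one_ne_zero
    have hc : coeff a F = 0 := by rw [hF0, coeff_zero]
    rw [hFdef, coeff_sum, Finset.sum_eq_single a] at hc
    · rw [coeff_C_mul] at hc
      exact mul_ne_zero hfa hha hc
    · intro b hb hne
      rw [coeff_C_mul]
      by_cases hz : coeff a (h b) = 0
      · rw [hz, mul_zero]
      exfalso
      rcases (hS b a (mem_support_iff.2 hz)).2 with h' | ⟨h1, h2⟩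
      · exact hne h'.symm
      · rw [mem_support_iff] at hb
        have hwb : expWeight w b = expWeight w a := by
          refine le_antisymm h1 (not_lt.1 fun hlt => hb (f1 b hlt))
        rw [f2 b hwb] at hb
        exact (wOrder vv).irrefl _ ((wOrder vv).trans _ _ _ h2 (hmin b (mem_support_iff.2 hb) hne))
    · intro h'
      exact absurd (mem_support_iff.2 hfa) h'
  · unfold NonCross at hnc
    push Not at hnc
    obtain ⟨i, j, l, m, hij, hjl, hlm, hle⟩ := hnc
    have e : (monomial a (1 : k)) = monomial (a - e2 i l (hij.trans hjl).ne j m (hjl.trans hlm).ne) 1 *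
        (X (pr i l (hij.trans hjl).ne) * X (pr j m (hjl.trans hlm).ne)) := by
      have hmul : (X (pr i l (hij.trans hjl).ne) * X (pr j m (hjl.trans hlm).ne) : MvPolynomial (Edge n) k)
          = monomial (e2 i l (hij.trans hjl).ne j m (hjl.trans hlm).ne) 1 := by
        simp [X, monomial_mul, e2]
      rw [hmul, monomial_mul, tsub_add_cancel_of_le hle, mul_one]
    rw [e]
    exact Ideal.mul_mem_left _ _ (Ideal.subset_span ⟨i, j, l, m, hij, hjl, hlm, rfl⟩)

end Helpers

/-- for every `w` with `in_w(I_{2,n})` monomial-free there are a permutation `π`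
of the indices and a monomial order `≺` such that `in_≺(in_{π·w}(I_{2,n}))` equals the
crossing ideal `M`.  Consequently a single maximal Gröbner cone of `I_{2,n}` contains, up to
permuting indices, all cones of the tropical Grassmannian `G_{2,n}`. -/
theorem exists_perm_monoOrder_ordInitIdeal_eq_crossingIdeal (k : Type) [Field k] (n : ℕ)
    (hn : 4 ≤ n) (w : {s : Finset (Fin n) // s.card = 2} → ℝ)
    (hw : MonomialFree (initIdeal w (pluckerIdeal k 2 n))) :
    ∃ (π : Equiv.Perm (Fin n)) (o : MonoOrder {s : Finset (Fin n) // s.card = 2}),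
      ordInitIdeal o (initIdeal (permWeight π w) (pluckerIdeal k 2 n)) = crossingIdeal k n := by
  obtain ⟨π, hπ⟩ := exists_perm k hn w hw
  exact ⟨π, wOrder vv, le_antisymm (le_crossing k _ hπ) (crossing_le k _ hπ)⟩
end

section
/- Let I_{3,7} be the Plücker ideal in k[p_{ijk} : 1 ≤ i < j < k ≤ 7], and define w′ ∈ ℝ^{C(7,3)} by w′_T = 1 if T is one of the six triples {2,3,5}, {3,4,6}, {4,5,7}, {1,5,6}, {2,6,7}, {1,3,7}, and w′_T = 0 otherwise (that is, w′ = w − e_{124} where w is the Fano-plane weight vector). Then: (i) if k has characteristic 2, the initial ideal in_{w′}(I_{3,7}) contains a monomial (namely p_{124}p_{367}p_{567}), so w′ ∉ G_{3,7} over k; and (ii) if k has characteristic 0, the initial ideal in_{w′}(I_{3,7}) contains no monomial, so w′ ∈ G_{3,7} over k. Consequently there is no inclusion in either direction between the tropical Grassmannians G_{3,7} in characteristic two and in characteristic zero. -/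
open scoped Classical

open MvPolynomial

/-- The variable index `p_{ijk}` for a `3`-element subset `{i,j,k}` of `{0,…,6}`
(representing `{1,…,7}`). -/
def tri7 (i j l : Fin 7) (h : ({i, j, l} : Finset (Fin 7)).card = 3) :
    {s : Finset (Fin 7) // s.card = 3} := ⟨{i, j, l}, h⟩

/-- The weight vector `w′ = w − e_{124}`: `w′_T = 1` if `T` is one of the six triples
`{2,3,5}, {3,4,6}, {4,5,7}, {1,5,6}, {2,6,7}, {1,3,7}` (the Fano lines other than
`{1,2,4}`, indices shifted to `{0,…,6}`), and `w′_T = 0` otherwise. -/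
noncomputable def wFano' (S : {s : Finset (Fin 7) // s.card = 3}) : ℝ :=
  if S.1 ∈ ({{1, 2, 4}, {2, 3, 5}, {3, 4, 6}, {0, 4, 5}, {1, 5, 6}, {0, 2, 6}} :
      Finset (Finset (Fin 7))) then 1
  else 0


theorem xx_expWeight_nat {σ : Type*} (n : σ → ℕ) (a : σ →₀ ℕ) :
    expWeight (fun i => (n i : ℝ)) a = ((a.sum fun i e => e * n i : ℕ) : ℝ) := by
  simp [expWeight, Finsupp.sum]

theorem xx_initForm_eval {σ : Type*} {k : Type*} [Field k] (n : σ → ℕ)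
    (u : σ → Polynomial k) (f : MvPolynomial σ k)
    (hf : aeval (fun i => Polynomial.X ^ n i * u i) f = 0) :
    aeval (fun i => (u i).eval 0) (initForm (fun i => (n i : ℝ)) f) = 0 := by
  by_cases h0 : f = 0
  · subst h0; simp [initForm]
  have hne : f.support.Nonempty := by
    rwa [Finset.nonempty_iff_ne_empty, Ne, MvPolynomial.support_eq_empty]
  set N : (σ →₀ ℕ) → ℕ := fun a => a.sum fun i e => e * n i with hN
  obtain ⟨a0, ha0, hmin⟩ := Finset.exists_min_image f.support N hne
  have key : aeval (fun i => Polynomial.X ^ n i * u i) f =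
      Polynomial.X ^ N a0 * ∑ a ∈ f.support, Polynomial.C (f.coeff a) *
        Polynomial.X ^ (N a - N a0) * a.prod (fun i e => u i ^ e) := by
    rw [MvPolynomial.aeval_def, MvPolynomial.eval₂_eq, Finset.mul_sum]
    refine Finset.sum_congr rfl fun a ha => ?_
    have e1 : ∏ i ∈ a.support, (Polynomial.X ^ n i * u i) ^ a i =
        Polynomial.X ^ N a * a.prod (fun i e => u i ^ e) := by
      simp only [hN, Finsupp.prod, Finsupp.sum, mul_pow, Finset.prod_mul_distrib,
        ← Finset.prod_pow_eq_pow_sum, ← pow_mul, mul_comm]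
    have e2 : (Polynomial.X : Polynomial k) ^ N a =
        Polynomial.X ^ N a0 * Polynomial.X ^ (N a - N a0) := by
      rw [← pow_add, Nat.add_sub_cancel' (hmin a ha)]
    rw [e1, e2, Polynomial.algebraMap_eq]
    ring
  rw [key] at hf
  have hs := (mul_eq_zero.mp hf).resolve_left (pow_ne_zero _ Polynomial.X_ne_zero)
  have hs' := congrArg (Polynomial.eval 0) hs
  rw [Polynomial.eval_finsetSum, Polynomial.eval_zero] at hs'
  refine Eq.trans ?_ hs'
  rw [initForm, map_sum, Finset.sum_filter]
  refine Finset.sum_congr rfl fun a ha => ?_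
  have hiff : (∀ b ∈ f.support, expWeight (fun i => (n i : ℝ)) a ≤
      expWeight (fun i => (n i : ℝ)) b) ↔ N a = N a0 := by
    simp only [xx_expWeight_nat, Nat.cast_le]
    constructor
    · intro h; exact le_antisymm (h a0 ha0) (hmin a ha)
    · intro h b hb
      change N a ≤ N b
      rw [h]; exact hmin b hb
  by_cases h : N a = N a0
  · rw [if_pos (hiff.2 h), h]
    simp [aeval_monomial, Finsupp.prod, Polynomial.eval_prod]
  · rw [if_neg (fun h' => h (hiff.1 h'))]
    have : N a - N a0 ≠ 0 := by have := hmin a ha; omega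
    simp [this]

theorem xx_mem_eval {σ : Type*} {k : Type*} [Field k] (n : σ → ℕ)
    (u : σ → Polynomial k) (I : Ideal (MvPolynomial σ k))
    (hI : ∀ f ∈ I, aeval (fun i => Polynomial.X ^ n i * u i) f = 0)
    (hu : ∀ i, (u i).eval 0 ≠ 0) :
    MonomialFree (initIdeal (fun i => (n i : ℝ)) I) := by
  rintro g hg ⟨a, c, hc, rfl⟩
  have hle : initIdeal (fun i => (n i : ℝ)) I ≤
      RingHom.ker (aeval (R := k) (fun i => (u i).eval 0)) := by
    rw [initIdeal, Ideal.span_le]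
    rintro _ ⟨f, hf, rfl⟩
    exact xx_initForm_eval n u f (hI f hf)
  have := hle hg
  rw [RingHom.mem_ker, aeval_monomial] at this
  refine (mul_ne_zero ?_ ?_) this
  · simpa using hc
  · exact Finset.prod_ne_zero_iff.2 fun i _ => pow_ne_zero _ (hu i)

theorem xx_initForm_add {σ : Type*} {k : Type*} [Field k] (w : σ → ℝ)
    (a : σ →₀ ℕ) (h : MvPolynomial σ k) (hh : ∀ b ∈ h.support, expWeight w a < expWeight w b) :
    initForm w (monomial a 1 + h) = monomial a 1 := by
  have hna : h.coeff a = 0 := by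
    by_contra hc
    exact lt_irrefl _ (hh a (MvPolynomial.mem_support_iff.2 hc))
  have hmem : a ∈ (monomial a (1 : k) + h).support := by
    simp [MvPolynomial.mem_support_iff, hna]
  have hsup : ∀ b ∈ (monomial a (1 : k) + h).support, b ≠ a → expWeight w a < expWeight w b := by
    intro b hb hba
    apply hh
    rw [MvPolynomial.mem_support_iff] at hb ⊢
    simpa [coeff_add, coeff_monomial, hba.symm] using hb
  have : (monomial a (1 : k) + h).support.filter (fun c => ∀ b ∈ (monomial a (1 : k) + h).support,
      expWeight w c ≤ expWeight w b) = {a} := by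
    ext c
    simp only [Finset.mem_filter, Finset.mem_singleton]
    constructor
    · rintro ⟨hc, hc'⟩
      by_contra hca
      exact absurd (hc' a hmem) (not_le.2 (hsup c hc hca))
    · rintro rfl
      refine ⟨hmem, fun b hb => ?_⟩
      by_cases hb' : b = c
      · rw [hb']
      · exact (hsup b hb hb').le
  rw [initForm, this, Finset.sum_singleton]
  simp [hna]

def xxdet {R : Type*} [CommRing R] (x : Fin 3 → Fin 7 → R) (i j l : Fin 7) : R :=
  x 0 i * x 1 j * x 2 l - x 0 i * x 1 l * x 2 j - x 0 j * x 1 i * x 2 l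
    + x 0 j * x 1 l * x 2 i + x 0 l * x 1 i * x 2 j - x 0 l * x 1 j * x 2 i

theorem xx_emb (S : {s : Finset (Fin 7) // s.card = 3}) (i j l : Fin 7)
    (hS : S.1 = {i, j, l}) (h1 : i < j)
    (h2 : j < l) : ∀ c, ((S.1.orderIsoOfFin S.2 c : S.1) : Fin 7) = ![i, j, l] c := by
  have := Finset.orderEmbOfFin_unique (s := S.1) S.2 (f := ![i, j, l])
    (by intro x; rw [hS]; fin_cases x <;> simp)
    (by
      rw [Fin.strictMono_iff_lt_succ]
      intro x; fin_cases x <;> simp [h1, h2])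
  intro c
  rw [this]; rfl

theorem xx_pmap (k : Type*) [CommRing k] (i j l : Fin 7)
    (h : ({i, j, l} : Finset (Fin 7)).card = 3) (h1 : i < j) (h2 : j < l) :
    pluckerMap k 3 7 (X (tri7 i j l h)) = xxdet (fun r c => X (r, c)) i j l := by
  have hS : (tri7 i j l h).1 = {i, j, l} := rfl
  generalize tri7 i j l h = S at hS
  have e0 := xx_emb S i j l hS h1 h2 0
  have e1 := xx_emb S i j l hS h1 h2 1
  have e2 := xx_emb S i j l hS h1 h2 2
  simp only [Matrix.cons_val_zero, Matrix.cons_val_one, Matrix.cons_val] at e0 e1 e2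
  rw [pluckerMap, aeval_X, Matrix.det_fin_three]
  simp only [Matrix.of_apply, xxdet]
  rw [e0, e1, e2]

theorem xx_exists (S : {s : Finset (Fin 7) // s.card = 3}) :
    ∃ i j l h, i < j ∧ j < l ∧ S = tri7 i j l h := by
  obtain ⟨S, hS⟩ := S
  set e := S.orderEmbOfFin hS
  have hS' : S = {e 0, e 1, e 2} := by
    have := Finset.image_orderEmbOfFin_univ S hS
    rw [← this]
    ext x
    simp only [Finset.mem_image, Finset.mem_univ, true_and, Fin.exists_fin_succ, e,
      Finset.mem_insert, Finset.mem_singleton]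
    simp [eq_comm]
  refine ⟨e 0, e 1, e 2, by rw [← hS']; exact hS, by simp, by simp, ?_⟩
  exact Subtype.ext hS'

theorem xx_identity {R : Type*} [CommRing R] (x : Fin 3 → Fin 7 → R) :
    xxdet x 0 1 3 * xxdet x 2 5 6 * xxdet x 4 5 6
    + (xxdet x 0 5 6 * xxdet x 3 5 6 * xxdet x 1 2 4
    + xxdet x 0 1 6 * xxdet x 4 5 6 * xxdet x 2 3 5
    + xxdet x 0 1 5 * xxdet x 2 5 6 * xxdet x 3 4 6
    + xxdet x 1 2 6 * xxdet x 3 5 6 * xxdet x 0 4 5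
    - xxdet x 0 2 3 * xxdet x 4 5 6 * xxdet x 1 5 6
    - xxdet x 1 3 5 * xxdet x 4 5 6 * xxdet x 0 2 6
    - xxdet x 0 2 5 * xxdet x 1 5 6 * xxdet x 3 4 6)
    = 2 * (xxdet x 0 1 2 * xxdet x 3 5 6 * xxdet x 4 5 6) := by
  unfold xxdet
  generalize x 0 0 = x00
  generalize x 0 1 = x01
  generalize x 0 2 = x02
  generalize x 0 3 = x03
  generalize x 0 4 = x04
  generalize x 0 5 = x05
  generalize x 0 6 = x06
  generalize x 1 0 = x10
  generalize x 1 1 = x11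
  generalize x 1 2 = x12
  generalize x 1 3 = x13
  generalize x 1 4 = x14
  generalize x 1 5 = x15
  generalize x 1 6 = x16
  generalize x 2 0 = x20
  generalize x 2 1 = x21
  generalize x 2 2 = x22
  generalize x 2 3 = x23
  generalize x 2 4 = x24
  generalize x 2 5 = x25
  generalize x 2 6 = x26
  ring

theorem xx_XXX {σ k : Type*} [Field k] (A B C : σ) :
    (X A * X B * X C : MvPolynomial σ k) =
      monomial (Finsupp.single A 1 + Finsupp.single B 1 + Finsupp.single C 1) 1 := by
  simp [X, monomial_mul]

theorem xx_wXXX {σ : Type*} (w : σ → ℝ) (A B C : σ) :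
    expWeight w (Finsupp.single A 1 + Finsupp.single B 1 + Finsupp.single C 1) =
      w A + w B + w C := by
  unfold expWeight
  rw [Finsupp.sum_add_index', Finsupp.sum_add_index'] <;>
    simp [add_mul]

def XXHeavy {σ k : Type*} [Field k] (w : σ → ℝ) (h : MvPolynomial σ k) : Prop :=
  ∀ b ∈ h.support, 0 < expWeight w b

theorem xx_heavy_add {σ k : Type*} [Field k] {w : σ → ℝ} {f g : MvPolynomial σ k}
    (hf : XXHeavy w f) (hg : XXHeavy w g) : XXHeavy w (f + g) := by
  intro b hb
  rcases Finset.mem_union.1 (MvPolynomial.support_add hb) with h | h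
  · exact hf b h
  · exact hg b h

theorem xx_heavy_sub {σ k : Type*} [Field k] {w : σ → ℝ} {f g : MvPolynomial σ k}
    (hf : XXHeavy w f) (hg : XXHeavy w g) : XXHeavy w (f - g) := by
  rw [sub_eq_add_neg]
  refine xx_heavy_add hf fun b hb => hg b ?_
  rwa [MvPolynomial.support_neg] at hb

theorem xx_heavy_X {σ k : Type*} [Field k] {w : σ → ℝ} (hw : ∀ i, 0 ≤ w i) {A B C : σ}
    (h : 0 < w C) : XXHeavy w (X A * X B * X C : MvPolynomial σ k) := by
  intro b hb
  rw [xx_XXX] at hb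
  have := Finset.mem_singleton.1 (MvPolynomial.support_monomial_subset hb)
  rw [this, xx_wXXX]
  linarith [hw A, hw B]

def xxlines : Finset (Finset (Fin 7)) :=
  {{1, 2, 4}, {2, 3, 5}, {3, 4, 6}, {0, 4, 5}, {1, 5, 6}, {0, 2, 6}}

def xxn (S : {s : Finset (Fin 7) // s.card = 3}) : ℕ :=
  if S.1 ∈ xxlines then 1 else 0

theorem xx_w_eq : wFano' = fun S => (xxn S : ℝ) := by
  funext S
  simp only [wFano', xxn, xxlines]
  split_ifs <;> simp_all

theorem xx_part1 (k : Type) [Field k] [CharP k 2] :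
    X (tri7 0 1 3 (by decide)) * X (tri7 2 5 6 (by decide)) * X (tri7 4 5 6 (by decide)) ∈
        initIdeal wFano' (pluckerIdeal k 3 7) := by
  set h : MvPolynomial {s : Finset (Fin 7) // s.card = 3} k :=
    (X (tri7 0 5 6 (by decide)) * X (tri7 3 5 6 (by decide)) * X (tri7 1 2 4 (by decide))
    + X (tri7 0 1 6 (by decide)) * X (tri7 4 5 6 (by decide)) * X (tri7 2 3 5 (by decide))
    + X (tri7 0 1 5 (by decide)) * X (tri7 2 5 6 (by decide)) * X (tri7 3 4 6 (by decide))
    + X (tri7 1 2 6 (by decide)) * X (tri7 3 5 6 (by decide)) * X (tri7 0 4 5 (by decide))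
    - X (tri7 0 2 3 (by decide)) * X (tri7 4 5 6 (by decide)) * X (tri7 1 5 6 (by decide))
    - X (tri7 1 3 5 (by decide)) * X (tri7 4 5 6 (by decide)) * X (tri7 0 2 6 (by decide))
    - X (tri7 0 2 5 (by decide)) * X (tri7 1 5 6 (by decide)) * X (tri7 3 4 6 (by decide)))
    with hh
  have hw : ∀ S, 0 ≤ wFano' S := by
    intro S; rw [xx_w_eq]; positivity
  have hheavy : XXHeavy wFano' h := by
    refine xx_heavy_sub (xx_heavy_sub (xx_heavy_sub (xx_heavy_add (xx_heavy_add (xx_heavy_add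
      ?_ ?_) ?_) ?_) ?_) ?_) ?_ <;>
    · refine xx_heavy_X hw ?_
      simp [wFano', tri7]
  have h0 : ∀ S, S.1 ∉ xxlines → wFano' S = 0 := by
    intro S hS; rw [xx_w_eq]; simp [xxn, hS]
  refine Ideal.subset_span ⟨X (tri7 0 1 3 (by decide)) * X (tri7 2 5 6 (by decide)) *
    X (tri7 4 5 6 (by decide)) + h, ?_, ?_⟩
  · rw [pluckerIdeal, RingHom.mem_ker, hh]
    simp only [map_add, map_sub, map_mul]
    repeat rw [xx_pmap _ _ _ _ _ (by decide) (by decide)]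
    rw [xx_identity]
    have : (2 : MvPolynomial (Fin 3 × Fin 7) k) = 0 := CharTwo.two_eq_zero
    rw [this, zero_mul]
  · rw [xx_XXX, xx_initForm_add]
    intro b hb
    rw [xx_wXXX, h0 _ (by simp only [tri7]; decide), h0 _ (by simp only [tri7]; decide),
      h0 _ (by simp only [tri7]; decide)]
    simpa using hheavy b hb

def xxa : Fin 3 → Fin 7 → ℤ :=
  ![![0, 1, 1, 1, 0, 0, 1], ![1, 1, 0, 0, 1, 0, 1], ![1, 0, 0, 1, 0, 1, 1]]

def xxb : Fin 3 → Fin 7 → ℤ :=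
  ![![1, 1, 0, 0, 0, 0, 0], ![1, 0, 0, 1, 0, 0, 0], ![0, 1, 0, 1, 0, 0, 0]]

def xxrow {R : Type*} [CommRing R] (p q r : Fin 7 → R) (i j l : Fin 7) : R :=
  p i * q j * r l - p i * q l * r j - p j * q i * r l
    + p j * q l * r i + p l * q i * r j - p l * q j * r i

theorem xxrow_cast {R : Type*} [CommRing R] (p q r : Fin 7 → ℤ) (i j l : Fin 7) :
    ((xxrow p q r i j l : ℤ) : R) =
      xxrow (fun c => (p c : R)) (fun c => (q c : R)) (fun c => (r c : R)) i j l := by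
  simp only [xxrow, Int.cast_add, Int.cast_sub, Int.cast_mul]

theorem xxrow_expand {R : Type*} [CommRing R] (a b c a' b' c' : Fin 7 → R) (t : R)
    (i j l : Fin 7) :
    xxrow (fun s => a s + a' s * t) (fun s => b s + b' s * t) (fun s => c s + c' s * t) i j l =
      xxrow a b c i j l
      + (xxrow a' b c i j l + xxrow a b' c i j l + xxrow a b c' i j l) * t
      + (xxrow a' b' c i j l + xxrow a' b c' i j l + xxrow a b' c' i j l) * t ^ 2
      + xxrow a' b' c' i j l * t ^ 3 := by
  simp only [xxrow]
  ring

def xxd1 (i j l : Fin 7) : ℤ :=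
  xxrow (xxb 0) (xxa 1) (xxa 2) i j l + xxrow (xxa 0) (xxb 1) (xxa 2) i j l
    + xxrow (xxa 0) (xxa 1) (xxb 2) i j l

def xxd2 (i j l : Fin 7) : ℤ :=
  xxrow (xxb 0) (xxb 1) (xxa 2) i j l + xxrow (xxb 0) (xxa 1) (xxb 2) i j l
    + xxrow (xxa 0) (xxb 1) (xxb 2) i j l

theorem xxdet_row {R : Type*} [CommRing R] (x : Fin 3 → Fin 7 → R) (i j l : Fin 7) :
    xxdet x i j l = xxrow (x 0) (x 1) (x 2) i j l := rfl

theorem xx_decide : ∀ i j l : Fin 7, i < j → j < l →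
    if ({i, j, l} : Finset (Fin 7)) ∈ xxlines then xxdet xxa i j l = 0 ∧ xxd1 i j l ≠ 0
      else xxdet xxa i j l ≠ 0 := by
  decide +kernel

noncomputable def xxmat (k : Type*) [Field k] (r : Fin 3) (j : Fin 7) : Polynomial k :=
  (xxa r j : Polynomial k) + (xxb r j : Polynomial k) * Polynomial.X

theorem xx_det_expand (k : Type*) [Field k] (i j l : Fin 7) :
    xxdet (xxmat k) i j l = ((xxdet xxa i j l : ℤ) : Polynomial k) + (xxd1 i j l : Polynomial k) *
      Polynomial.X + (xxd2 i j l : Polynomial k) * Polynomial.X ^ 2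
      + ((xxdet xxb i j l : ℤ) : Polynomial k) * Polynomial.X ^ 3 := by
  rw [xxdet_row, xxdet_row, xxdet_row]
  unfold xxd1 xxd2
  rw [Int.cast_add, Int.cast_add, Int.cast_add, Int.cast_add]
  simp only [xxrow_cast]
  exact xxrow_expand _ _ _ _ _ _ _ i j l

theorem xx_part2 (k : Type) [Field k] [CharZero k] :
    MonomialFree (initIdeal wFano' (pluckerIdeal k 3 7)) := by
  let φ : MvPolynomial (Fin 3 × Fin 7) k →ₐ[k] Polynomial k := aeval fun p => xxmat k p.1 p.2
  have hex : ∀ S, ∃ u : Polynomial k, φ (pluckerMap k 3 7 (X S)) = Polynomial.X ^ xxn S * u ∧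
      u.eval 0 ≠ 0 := by
    intro S
    obtain ⟨i, j, l, h, h1, h2, rfl⟩ := xx_exists S
    have e : φ (pluckerMap k 3 7 (X (tri7 i j l h))) = xxdet (xxmat k) i j l := by
      rw [xx_pmap _ _ _ _ _ h1 h2]
      simp [xxdet, φ]
    rw [e, xx_det_expand]
    have hd := xx_decide i j l h1 h2
    by_cases hl : ({i, j, l} : Finset (Fin 7)) ∈ xxlines
    · rw [if_pos hl] at hd
      refine ⟨(xxd1 i j l : Polynomial k) + (xxd2 i j l : Polynomial k) * Polynomial.X
        + ((xxdet xxb i j l : ℤ) : Polynomial k) * Polynomial.X ^ 2, ?_, ?_⟩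
      · have : xxn (tri7 i j l h) = 1 := if_pos hl
        rw [this, hd.1]
        push_cast
        ring
      · simpa using hd.2
    · rw [if_neg hl] at hd
      have : xxn (tri7 i j l h) = 0 := if_neg hl
      refine ⟨_, by rw [this, pow_zero, one_mul], ?_⟩
      simpa using hd
  choose u hu hu0 using hex
  rw [xx_w_eq]
  refine xx_mem_eval xxn u _ (fun f hf => ?_) hu0
  have : aeval (fun S => Polynomial.X ^ xxn S * u S) = φ.comp (pluckerMap k 3 7) := by
    apply MvPolynomial.algHom_ext
    intro S
    rw [aeval_X, AlgHom.comp_apply, hu]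
  rw [this, AlgHom.comp_apply]
  rw [pluckerIdeal, RingHom.mem_ker] at hf
  rw [hf, map_zero]

/-- (i) over a field of characteristic two, `in_{w′}(I_{3,7})` contains the
monomial `p_{124}p_{367}p_{567}`, so `w′ ∉ G_{3,7}`; (ii) over a field of characteristic
zero, `in_{w′}(I_{3,7})` contains no monomial, so `w′ ∈ G_{3,7}`.  Hence neither of the
tropical Grassmannians `G_{3,7}` in characteristics two and zero contains the other. -/
theorem fanoMinus_initIdeal_char_two_vs_char_zero
    (k₁ : Type) [Field k₁] [CharP k₁ 2] (k₂ : Type) [Field k₂] [CharZero k₂] :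
    (X (tri7 0 1 3 (by decide)) * X (tri7 2 5 6 (by decide)) * X (tri7 4 5 6 (by decide)) ∈
        initIdeal wFano' (pluckerIdeal k₁ 3 7))
    ∧ MonomialFree (initIdeal wFano' (pluckerIdeal k₂ 3 7)) := by
  exact ⟨xx_part1 k₁, xx_part2 k₂⟩
end
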